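/- Let 0<q<1 and a,b ∈ ℝ with |a| + |b| < 1, and let x ≥ 0. Then the improper integral \int_x^\infty e^{-t} R(a,b,q,t)\,dt converges and equals e^{-x}\left(1 + \sum_{n=1}^\infty \sum_{k=0}^{n} \sum_{r=0}^{n} q^{r(r-1)/2} \binom{n}{r}_q a^{n-r} b^r \frac{x^k}{k!}\right). -/

import Mathlib

open Finset MeasureTheory

/-- The Ramanujan function `R(a,b,q,x) = 1 + ∑_{n≥1} (xⁿ/n!) ∏_{j=0}^{n-1} (a + b qʲ)`,
written as a single `tsum` (the `n = 0` term equals `1`). -/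
noncomputable def ramanujanR (a b q x : ℝ) : ℝ :=
  ∑' n : ℕ, x ^ n / (Nat.factorial n : ℝ) * ∏ j ∈ Finset.range n, (a + b * q ^ j)

/-- The Gaussian binomial coefficient `(n r)_q`. -/
noncomputable def gaussBinom (q : ℝ) (n r : ℕ) : ℝ :=
  if r ≤ n then
    (∏ i ∈ Finset.range r, (1 - q ^ (n - i))) / ∏ i ∈ Finset.range r, (1 - q ^ (i + 1))
  else 0

lemma gaussBinom_succ_succ {q : ℝ} (hq0 : 0 < q) (hq1 : q < 1) {n r : ℕ} (h : r ≤ n) :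
    gaussBinom q (n + 1) (r + 1) = gaussBinom q n (r + 1) + q ^ (n - r) * gaussBinom q n r := by
  have hne (m : ℕ) : 1 - q ^ (m + 1) ≠ 0 :=
    (sub_pos.2 (pow_lt_one₀ hq0.le hq1 m.succ_ne_zero)).ne'
  have hprod : ∏ i ∈ range r, (1 - q ^ (i + 1)) ≠ 0 := prod_ne_zero_iff.2 fun i _ => hne i
  have hr := hne r
  have hlow : gaussBinom q n (r + 1) =
      (∏ i ∈ range (r + 1), (1 - q ^ (n - i))) / ∏ i ∈ range (r + 1), (1 - q ^ (i + 1)) := by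
    unfold gaussBinom
    split_ifs with hn
    · rfl
    · obtain rfl : n = r := by omega
      simp [prod_range_succ]
  have hpow : q ^ (n + 1) = q ^ (n - r) * q ^ (r + 1) := by rw [← pow_add]; congr 1; omega
  rw [hlow, gaussBinom, if_pos (by omega), gaussBinom, if_pos h, prod_range_succ',
    prod_range_succ (fun i => 1 - q ^ (n - i)), prod_range_succ (fun i => 1 - q ^ (i + 1))]
  simp only [Nat.add_sub_add_right, Nat.sub_zero, hpow]
  field_simp
  ring

/-- The finite `q`-binomial theorem. -/
lemma prod_add_mul_pow_eq_sum_gaussBinom {q : ℝ} (hq0 : 0 < q) (hq1 : q < 1) (a b : ℝ) (n : ℕ) :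
    ∏ j ∈ range n, (a + b * q ^ j) =
      ∑ r ∈ range (n + 1), q ^ (r * (r - 1) / 2) * gaussBinom q n r * a ^ (n - r) * b ^ r := by
  induction n with
  | zero => simp [gaussBinom]
  | succ n ih =>
    have hstep : ∀ r ∈ range (n + 1),
        q ^ ((r + 1) * (r + 1 - 1) / 2) * gaussBinom q (n + 1) (r + 1) * a ^ (n + 1 - (r + 1)) *
          b ^ (r + 1) =
        q ^ ((r + 1) * (r + 1 - 1) / 2) * gaussBinom q n (r + 1) * a ^ (n - r) * b ^ (r + 1) +
          q ^ (r * (r - 1) / 2) * gaussBinom q n r * a ^ (n - r) * b ^ r * (b * q ^ n) := by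
      intro r hr
      have hrn : r ≤ n := by simpa [Nat.lt_succ_iff] using hr
      have htri : (r + 1) * (r + 1 - 1) / 2 = r * (r - 1) / 2 + r := by
        have := Finset.sum_range_id (r + 1)
        rw [Finset.sum_range_succ, Finset.sum_range_id] at this
        exact this.symm
      have hpow : q ^ n = q ^ r * q ^ (n - r) := by rw [← pow_add]; congr 1; omega
      rw [gaussBinom_succ_succ hq0 hq1 hrn, htri, Nat.add_sub_add_right, hpow]
      ring
    have hshift : (∑ r ∈ range (n + 1), q ^ (r * (r - 1) / 2) * gaussBinom q n r *
          a ^ (n - r) * b ^ r) * a =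
        (∑ r ∈ range (n + 1), q ^ ((r + 1) * (r + 1 - 1) / 2) * gaussBinom q n (r + 1) *
          a ^ (n - r) * b ^ (r + 1)) + a ^ (n + 1) := by
      rw [sum_range_succ', sum_range_succ _ n, add_mul, sum_mul]
      have hz : gaussBinom q n (n + 1) = 0 := by simp [gaussBinom]
      have h0 : gaussBinom q n 0 = 1 := by simp [gaussBinom]
      rw [hz, h0]
      simp only [mul_zero, zero_mul, add_zero, Nat.sub_zero, pow_zero, Nat.zero_div, one_mul,
        mul_one, pow_succ a n, add_left_inj]
      refine sum_congr rfl fun r hr => ?_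
      have : n - r = n - (r + 1) + 1 := by have := mem_range.1 hr; omega
      rw [this, pow_succ a]
      ring
    have h0 : gaussBinom q (n + 1) 0 = 1 := by simp [gaussBinom]
    rw [prod_range_succ, ih, sum_range_succ' _ (n + 1), sum_congr rfl hstep, sum_add_distrib, mul_add,
      hshift, h0, ← sum_mul]
    simp
    ring

lemma hasDerivAt_neg_exp_neg_mul_sum (n : ℕ) (t : ℝ) :
    HasDerivAt (fun t => -(Real.exp (-t) * ∑ k ∈ range (n + 1), t ^ k / (k.factorial : ℝ)))
      (Real.exp (-t) * (t ^ n / (n.factorial : ℝ))) t := by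
  have hexp : HasDerivAt (fun t : ℝ => Real.exp (-t)) (-Real.exp (-t)) t := by
    simpa using (hasDerivAt_neg t).exp
  have hsum : HasDerivAt (fun t : ℝ => ∑ k ∈ range (n + 1), t ^ k / (k.factorial : ℝ))
      (∑ k ∈ range n, t ^ k / (k.factorial : ℝ)) t := by
    have := HasDerivAt.fun_sum (u := range (n + 1)) (x := t) fun k _ =>
      (hasDerivAt_pow k t).div_const (k.factorial : ℝ)
    refine this.congr_deriv ?_
    rw [sum_range_succ']
    simp only [Nat.cast_zero, zero_mul, zero_div, add_zero]
    refine sum_congr rfl fun k _ => ?_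
    rw [Nat.factorial_succ, Nat.add_sub_cancel]
    have : (k.factorial : ℝ) ≠ 0 := by positivity
    push_cast
    field_simp
  refine (hexp.mul hsum).neg.congr_deriv ?_
  rw [sum_range_succ]
  ring

lemma tendsto_neg_exp_neg_mul_sum (n : ℕ) :
    Filter.Tendsto
      (fun t : ℝ => -(Real.exp (-t) * ∑ k ∈ range (n + 1), t ^ k / (k.factorial : ℝ)))
      Filter.atTop (nhds 0) := by
  simp only [mul_sum]
  rw [← neg_zero, ← Finset.sum_const_zero (s := range (n + 1))]
  refine (tendsto_finsetSum _ fun k _ => ?_).neg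
  have := (Real.tendsto_pow_mul_exp_neg_atTop_nhds_zero k).div_const (k.factorial : ℝ)
  rw [zero_div] at this
  exact this.congr fun t => by ring

lemma exp_neg_mul_pow_div_factorial_nonneg {x t : ℝ} (hx : 0 ≤ x) (ht : t ∈ Set.Ioi x) (n : ℕ) :
    0 ≤ Real.exp (-t) * (t ^ n / (n.factorial : ℝ)) := by
  have : 0 ≤ t := hx.trans ht.le
  positivity

lemma integrableOn_exp_neg_mul_pow_div_factorial {x : ℝ} (hx : 0 ≤ x) (n : ℕ) :
    IntegrableOn (fun t => Real.exp (-t) * (t ^ n / (n.factorial : ℝ))) (Set.Ioi x) :=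
  integrableOn_Ioi_deriv_of_nonneg' (fun t _ => hasDerivAt_neg_exp_neg_mul_sum n t)
    (fun _ ht => exp_neg_mul_pow_div_factorial_nonneg hx ht n) (tendsto_neg_exp_neg_mul_sum n)

/-- The upper incomplete gamma function `Γ(n + 1, x)`, divided by `n!`. -/
lemma integral_exp_neg_mul_pow_div_factorial {x : ℝ} (hx : 0 ≤ x) (n : ℕ) :
    ∫ t in Set.Ioi x, Real.exp (-t) * (t ^ n / (n.factorial : ℝ)) =
      Real.exp (-x) * ∑ k ∈ range (n + 1), x ^ k / (k.factorial : ℝ) := by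
  rw [integral_Ioi_of_hasDerivAt_of_nonneg' (fun t _ => hasDerivAt_neg_exp_neg_mul_sum n t)
    (fun _ ht => exp_neg_mul_pow_div_factorial_nonneg hx ht n) (tendsto_neg_exp_neg_mul_sum n)]
  ring

lemma abs_prod_add_mul_pow_le {q : ℝ} (hq0 : 0 < q) (hq1 : q < 1) (a b : ℝ) (n : ℕ) :
    |∏ j ∈ range n, (a + b * q ^ j)| ≤ (|a| + |b|) ^ n := by
  rw [abs_prod]
  calc ∏ j ∈ range n, |a + b * q ^ j| ≤ ∏ _j ∈ range n, (|a| + |b|) := by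
        refine prod_le_prod (fun _ _ => abs_nonneg _) fun j _ => (abs_add_le _ _).trans ?_
        rw [abs_mul, abs_of_pos (pow_pos hq0 j)]
        gcongr
        exact mul_le_of_le_one_right (abs_nonneg b) (pow_le_one₀ hq0.le hq1.le)
    _ = (|a| + |b|) ^ n := by simp

lemma hasSum_exp_neg_mul_ramanujanR {q : ℝ} (hq0 : 0 < q) (hq1 : q < 1) (a b t : ℝ) :
    HasSum (fun n : ℕ => (∏ j ∈ range n, (a + b * q ^ j)) *
      (Real.exp (-t) * (t ^ n / (n.factorial : ℝ)))) (Real.exp (-t) * ramanujanR a b q t) := by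
  have hsummable : Summable fun n : ℕ =>
      t ^ n / (n.factorial : ℝ) * ∏ j ∈ range n, (a + b * q ^ j) := by
    refine (Real.summable_pow_div_factorial (|t| * (|a| + |b|))).of_norm_bounded fun n => ?_
    rw [Real.norm_eq_abs, abs_mul, abs_div, abs_pow, Nat.abs_cast, mul_pow, mul_div_right_comm]
    exact mul_le_mul_of_nonneg_left (abs_prod_add_mul_pow_le hq0 hq1 a b n) (by positivity)
  have hsum := hsummable.hasSum.mul_left (Real.exp (-t))
  refine hsum.congr_fun fun n => ?_
  ring

lemma abs_ramanujanR_le {q : ℝ} (hq0 : 0 < q) (hq1 : q < 1) (a b : ℝ) {t : ℝ} (ht : 0 ≤ t) :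
    |ramanujanR a b q t| ≤ Real.exp ((|a| + |b|) * t) := by
  have hexp : HasSum (fun n : ℕ => ((|a| + |b|) * t) ^ n / (n.factorial : ℝ))
      (Real.exp ((|a| + |b|) * t)) := by
    rw [Real.exp_eq_exp_ℝ]
    exact NormedSpace.expSeries_div_hasSum_exp _
  rw [← Real.norm_eq_abs, ramanujanR]
  refine tsum_of_norm_bounded hexp fun n => ?_
  rw [Real.norm_eq_abs, abs_mul, abs_of_nonneg (by positivity : 0 ≤ t ^ n / (n.factorial : ℝ)),
    mul_comm, mul_pow, mul_div_assoc]
  exact mul_le_mul_of_nonneg_right (abs_prod_add_mul_pow_le hq0 hq1 a b n) (by positivity)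

lemma integrableOn_exp_neg_mul_ramanujanR {q : ℝ} (hq0 : 0 < q) (hq1 : q < 1) {a b : ℝ}
    (hab : |a| + |b| < 1) {x : ℝ} (hx : 0 ≤ x) :
    IntegrableOn (fun t => Real.exp (-t) * ramanujanR a b q t) (Set.Ioi x) := by
  refine (integrableOn_exp_mul_Ioi (sub_neg.2 hab) x).mono' ?_ ?_
  · refine aestronglyMeasurable_of_tendsto_ae Filter.atTop (fun N => ?_) <|
      Filter.Eventually.of_forall fun t =>
        (hasSum_exp_neg_mul_ramanujanR hq0 hq1 a b t).tendsto_sum_nat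
    exact Continuous.aestronglyMeasurable (by fun_prop)
  · filter_upwards [ae_restrict_mem measurableSet_Ioi] with t ht
    rw [Real.norm_eq_abs, abs_mul, Real.abs_exp, sub_mul, sub_eq_neg_add, one_mul, Real.exp_add]
    exact mul_le_mul_of_nonneg_left (abs_ramanujanR_le hq0 hq1 a b (hx.trans ht.le))
      (Real.exp_pos _).le

lemma exp_neg_mul_sum_pow_div_factorial_le_one {x : ℝ} (hx : 0 ≤ x) (n : ℕ) :
    Real.exp (-x) * ∑ k ∈ range (n + 1), x ^ k / (k.factorial : ℝ) ≤ 1 := by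
  calc _ ≤ Real.exp (-x) * Real.exp x := by
        gcongr
        exact Real.sum_le_exp_of_nonneg hx _
    _ = 1 := by rw [← Real.exp_add, neg_add_cancel, Real.exp_zero]

lemma hasSum_integral_exp_neg_mul_ramanujanR {q : ℝ} (hq0 : 0 < q) (hq1 : q < 1) {a b : ℝ}
    (hab : |a| + |b| < 1) {x : ℝ} (hx : 0 ≤ x) :
    HasSum (fun n : ℕ => (∏ j ∈ range n, (a + b * q ^ j)) *
      (Real.exp (-x) * ∑ k ∈ range (n + 1), x ^ k / (k.factorial : ℝ)))
      (∫ t in Set.Ioi x, Real.exp (-t) * ramanujanR a b q t) := by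
  have hsum := hasSum_integral_of_summable_integral_norm (μ := volume.restrict (Set.Ioi x))
    (F := fun n t => (∏ j ∈ range n, (a + b * q ^ j)) *
      (Real.exp (-t) * (t ^ n / (n.factorial : ℝ))))
    (fun n => (integrableOn_exp_neg_mul_pow_div_factorial hx n).const_mul _) ?_
  · simpa only [integral_const_mul, integral_exp_neg_mul_pow_div_factorial hx,
      (hasSum_exp_neg_mul_ramanujanR hq0 hq1 a b _).tsum_eq] using hsum
  · refine (summable_geometric_of_lt_one (by positivity) hab).of_nonneg_of_le
      (fun n => integral_nonneg fun t => norm_nonneg _) fun n => ?_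
    have hnorm : ∫ t in Set.Ioi x, ‖Real.exp (-t) * (t ^ n / (n.factorial : ℝ))‖ =
        Real.exp (-x) * ∑ k ∈ range (n + 1), x ^ k / (k.factorial : ℝ) := by
      rw [← integral_exp_neg_mul_pow_div_factorial hx]
      exact setIntegral_congr_fun measurableSet_Ioi fun t ht =>
        Real.norm_of_nonneg (exp_neg_mul_pow_div_factorial_nonneg hx ht n)
    simp only [norm_mul _ (Real.exp _ * _), integral_const_mul, hnorm]
    rw [← mul_one ((|a| + |b|) ^ n)]
    refine mul_le_mul (abs_prod_add_mul_pow_le hq0 hq1 a b n)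
      (exp_neg_mul_sum_pow_div_factorial_le_one hx n) (by positivity) (by positivity)

/-- For `|a| + |b| < 1` and `x ≥ 0`, the improper integral `∫_x^∞ e^{-t} R(a,b,q,t) dt`
converges and equals
`e^{-x} (1 + ∑_{n≥1} ∑_{k=0}^{n} ∑_{r=0}^{n} q^{r(r-1)/2} (n r)_q a^{n-r} bʳ x^k/k!)`,
the outer series (indexed below by `n+1`) being convergent. -/
theorem stmt_7 (q a b : ℝ) (hq0 : 0 < q) (hq1 : q < 1) (hab : |a| + |b| < 1)
    (x : ℝ) (hx : 0 ≤ x) :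
    IntegrableOn (fun t => Real.exp (-t) * ramanujanR a b q t) (Set.Ioi x) ∧
    Summable (fun n : ℕ =>
      ∑ k ∈ Finset.range (n + 2), ∑ r ∈ Finset.range (n + 2),
        q ^ (r * (r - 1) / 2) * gaussBinom q (n + 1) r * a ^ (n + 1 - r) * b ^ r *
          (x ^ k / (Nat.factorial k : ℝ))) ∧
    ∫ t in Set.Ioi x, Real.exp (-t) * ramanujanR a b q t =
      Real.exp (-x) *
        (1 + ∑' n : ℕ,
          ∑ k ∈ Finset.range (n + 2), ∑ r ∈ Finset.range (n + 2),
            q ^ (r * (r - 1) / 2) * gaussBinom q (n + 1) r * a ^ (n + 1 - r) * b ^ r *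
              (x ^ k / (Nat.factorial k : ℝ))) := by
  have hterm (n : ℕ) :
      ∑ k ∈ Finset.range (n + 2), ∑ r ∈ Finset.range (n + 2),
        q ^ (r * (r - 1) / 2) * gaussBinom q (n + 1) r * a ^ (n + 1 - r) * b ^ r *
          (x ^ k / (Nat.factorial k : ℝ)) =
      Real.exp x * ((∏ j ∈ range (n + 1), (a + b * q ^ j)) *
        (Real.exp (-x) * ∑ k ∈ range (n + 1 + 1), x ^ k / (k.factorial : ℝ))) := by
    rw [mul_left_comm, ← mul_assoc (Real.exp x), ← Real.exp_add, add_neg_cancel, Real.exp_zero,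
      one_mul, prod_add_mul_pow_eq_sum_gaussBinom hq0 hq1, mul_sum]
    exact sum_congr rfl fun k _ => (sum_mul ..).symm
  have hsum := hasSum_integral_exp_neg_mul_ramanujanR hq0 hq1 hab hx
  simp only [hterm]
  refine ⟨integrableOn_exp_neg_mul_ramanujanR hq0 hq1 hab hx,
    ((summable_nat_add_iff 1).2 hsum.summable).mul_left _, ?_⟩
  rw [tsum_mul_left, mul_add, ← mul_assoc, ← Real.exp_add, neg_add_cancel, Real.exp_zero,
    one_mul, ← hsum.tsum_eq, hsum.summable.tsum_eq_zero_add]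
  simp
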